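/- arXiv:2212.05694 — 4 statements merged into one kernel-verified Lean document; each statement's English description precedes it below -/
import Mathlib

section
/- For all real a, b ≥ 0, the AGM sequences (uᵢ) and (vᵢ) started from (a, b) both converge, and they converge to the same limit: there exists M ∈ ℝ such that uᵢ → M and vᵢ → M as i → ∞. -/
open Real Filter Topology

/-- The AGM iteration: `agmSeq a b i = (uᵢ, vᵢ)` with `u₀ = a`, `v₀ = b`,
`u_{i+1} = (uᵢ+vᵢ)/2`, `v_{i+1} = √(uᵢ vᵢ)`. -/
noncomputable def agmSeq (a b : ℝ) : ℕ → ℝ × ℝ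
  | 0 => (a, b)
  | i + 1 => (((agmSeq a b i).1 + (agmSeq a b i).2) / 2,
      Real.sqrt ((agmSeq a b i).1 * (agmSeq a b i).2))

theorem agmSeq_nonneg {a b : ℝ} (ha : 0 ≤ a) (hb : 0 ≤ b) (i : ℕ) :
    0 ≤ (agmSeq a b i).1 ∧ 0 ≤ (agmSeq a b i).2 := by
  induction i with
  | zero => exact ⟨ha, hb⟩
  | succ i ih => exact ⟨div_nonneg (add_nonneg ih.1 ih.2) zero_le_two, Real.sqrt_nonneg _⟩

theorem agmSeq_fst_succ (a b : ℝ) (i : ℕ) :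
    (agmSeq a b (i + 1)).1 = ((agmSeq a b i).1 + (agmSeq a b i).2) / 2 := rfl

theorem agmSeq_succ_snd_le_fst {a b : ℝ} (ha : 0 ≤ a) (hb : 0 ≤ b) (i : ℕ) :
    (agmSeq a b (i + 1)).2 ≤ (agmSeq a b (i + 1)).1 := by
  obtain ⟨hu, hv⟩ := agmSeq_nonneg ha hb i
  refine Real.sqrt_le_iff.mpr ⟨div_nonneg (add_nonneg hu hv) zero_le_two, ?_⟩
  rw [agmSeq_fst_succ]
  nlinarith [sq_nonneg ((agmSeq a b i).1 - (agmSeq a b i).2)]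

theorem antitone_agmSeq_succ_fst {a b : ℝ} (ha : 0 ≤ a) (hb : 0 ≤ b) :
    Antitone fun i => (agmSeq a b (i + 1)).1 := by
  refine antitone_nat_of_succ_le fun i => ?_
  linarith [agmSeq_succ_snd_le_fst ha hb i, agmSeq_fst_succ a b (i + 1)]

theorem agm_converges (a b : ℝ) (ha : 0 ≤ a) (hb : 0 ≤ b) :
    ∃ M : ℝ, Tendsto (fun i => (agmSeq a b i).1) atTop (𝓝 M) ∧
      Tendsto (fun i => (agmSeq a b i).2) atTop (𝓝 M) := by
  have hbdd : BddBelow (Set.range fun i => (agmSeq a b (i + 1)).1) :=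
    ⟨0, Set.forall_mem_range.mpr fun i => (agmSeq_nonneg ha hb (i + 1)).1⟩
  have hsucc := tendsto_atTop_ciInf (antitone_agmSeq_succ_fst ha hb) hbdd
  have hu := (tendsto_add_atTop_iff_nat (f := fun i => (agmSeq a b i).1) 1).mp hsucc
  refine ⟨_, hu, ?_⟩
  convert (hsucc.const_mul 2).sub hu using 2 with i
  · linarith [agmSeq_fst_succ a b i]
  · ring
end

section
/- For every real x with 0 ≤ x < 1, if M is the common limit of the AGM sequences started from (1 + x, 1 − x), then 1/M = Σ_{j=0}^∞ ((2j−1)!!/(2j)!!)² · x^{2j}. -/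
open Real Filter Topology

/-- The complete elliptic integral of the first kind. -/
noncomputable def K (k : ℝ) : ℝ :=
  ∫ u in (0:ℝ)..(π/2), (1 - k^2 * Real.sin u ^ 2) ^ (-(1/2) : ℝ)

/-- The ratio of double factorials (2j-1)!!/(2j)!!. -/
noncomputable def dfr (j : ℕ) : ℝ :=
  (Nat.doubleFactorial (2*j - 1) : ℝ) / (Nat.doubleFactorial (2*j) : ℝ)

theorem dfr_zero : dfr 0 = 1 := by simp [dfr]

theorem dfr_succ (n : ℕ) : dfr (n + 1) = dfr n * ((2 * n + 1) / (2 * n + 2)) := by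
  have hodd : Nat.doubleFactorial (2 * (n + 1) - 1)
      = (2 * n + 1) * Nat.doubleFactorial (2 * n - 1) := by
    rw [show 2 * (n + 1) - 1 = 2 * n + 1 by omega, Nat.doubleFactorial_add_one]
  have heven : Nat.doubleFactorial (2 * (n + 1)) = (2 * n + 2) * Nat.doubleFactorial (2 * n) := by
    rw [show 2 * (n + 1) = 2 * n + 2 by ring, Nat.doubleFactorial_add_two]
  rw [dfr, dfr, hodd, heven]
  push_cast
  rw [div_mul_div_comm]
  ring

theorem dfr_eq_prod (n : ℕ) :
    dfr n = ∏ i ∈ Finset.range n, ((2 * i + 1) / (2 * i + 2) : ℝ) := by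
  induction n with
  | zero => simp [dfr_zero]
  | succ n ih => rw [dfr_succ, Finset.prod_range_succ, ih]

theorem dfr_nonneg (n : ℕ) : 0 ≤ dfr n := by
  unfold dfr; positivity

theorem dfr_le_one (n : ℕ) : dfr n ≤ 1 := by
  induction n with
  | zero => simp [dfr_zero]
  | succ n ih =>
    rw [dfr_succ]
    refine mul_le_one₀ ih (by positivity) ?_
    rw [div_le_one (by positivity)]
    linarith

theorem ring_choose_neg_half (n : ℕ) :
    Ring.choose (-1 / 2 : ℂ) n = (-1) ^ n * (dfr n : ℂ) := by
  induction n with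
  | zero => simp [dfr_zero]
  | succ n ih =>
    rw [Ring.choose_eq_smul] at ih ⊢
    rw [descPochhammer_succ_right, Polynomial.smeval_mul, Nat.factorial_succ, dfr_succ]
    simp only [Polynomial.smeval_sub, Polynomial.smeval_X, Polynomial.smeval_natCast,
      smul_eq_mul, pow_one, pow_zero, nsmul_eq_mul, mul_one] at ih ⊢
    push_cast
    have hn : (n : ℂ) + 1 ≠ 0 := by exact_mod_cast n.succ_ne_zero
    have hn2 : (2 : ℂ) * n + 2 ≠ 0 := by
      rw [show (2 : ℂ) * n + 2 = 2 * (n + 1) by ring]; exact mul_ne_zero two_ne_zero hn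
    calc _ = ((n.factorial : ℂ)⁻¹ * (descPochhammer ℤ n).smeval (-1 / 2 : ℂ))
          * ((-1 / 2 - n) / (n + 1)) := by
          rw [mul_inv]; ring
      _ = _ := by
          rw [ih, pow_succ]
          field_simp
          ring

/-- The binomial series of `(1 - z) ^ (-1/2)`. -/
theorem hasSum_dfr_mul_pow {z : ℂ} (hz : ‖z‖ < 1) :
    HasSum (fun n ↦ (dfr n : ℂ) * z ^ n) ((1 - z) ^ (-1 / 2 : ℂ)) := by
  have h := (Complex.one_add_cpow_hasFPowerSeriesOnBall_zero (a := (-1 / 2 : ℂ))).hasSum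
    (y := -z) (by
      rw [← ENNReal.ofReal_one, Metric.eball_ofReal]
      simpa using hz)
  simp only [binomialSeries_apply, zero_add, List.ofFn_const,
    List.prod_replicate, smul_eq_mul, ring_choose_neg_half] at h
  rw [← sub_eq_add_neg] at h
  convert! h using 1
  funext n
  rw [mul_right_comm, ← mul_pow, neg_one_mul, neg_neg, mul_comm]

theorem hasSum_dfr_mul_pow_real {y : ℝ} (hy0 : 0 ≤ y) (hy : y < 1) :
    HasSum (fun n ↦ dfr n * y ^ n) ((1 - y) ^ (-1 / 2 : ℝ)) := by
  have h := hasSum_dfr_mul_pow (z := (y : ℂ)) (by simpa [abs_of_nonneg hy0] using hy)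
  rw [show (1 - (y : ℂ)) ^ (-1 / 2 : ℂ) = (((1 - y) ^ (-1 / 2 : ℝ) : ℝ) : ℂ) by
    rw [Complex.ofReal_cpow (by linarith)]; push_cast; rfl] at h
  exact_mod_cast h

theorem integral_exp_two_mul_int (m : ℤ) :
    ∫ θ in (0 : ℝ)..π, Complex.exp (2 * m * Complex.I * θ) = if m = 0 then (π : ℂ) else 0 := by
  split_ifs with hm
  · simp [hm]
  · have hc : (2 * m * Complex.I : ℂ) ≠ 0 := by simp [hm]
    rw [integral_exp_mul_complex hc]
    rw [show (2 * m * Complex.I : ℂ) * (π : ℝ) = m * (2 * π * Complex.I) by ring,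
      Complex.exp_int_mul_two_pi_mul_I]
    simp

/-- Parseval's identity for an absolutely convergent power series on the unit circle. -/
theorem integral_norm_sq_eq_tsum {c : ℕ → ℝ} (hc : Summable fun n ↦ |c n|) {g : ℝ → ℂ}
    (hg : ∀ θ : ℝ, HasSum (fun n ↦ (c n : ℂ) * Complex.exp (2 * n * Complex.I * θ)) (g θ)) :
    ∫ θ in (0 : ℝ)..π, ‖g θ‖ ^ 2 = π * ∑' n, c n ^ 2 := by
  have hcn : ∀ (n : ℕ) (θ : ℝ), ‖(c n : ℂ) * Complex.exp (2 * n * Complex.I * θ)‖ = |c n| := by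
    intro n θ
    rw [norm_mul, show (2 * n * Complex.I * θ : ℂ) = ((2 * n * θ : ℝ) : ℂ) * Complex.I by
      push_cast; ring, Complex.norm_exp_ofReal_mul_I, mul_one, Complex.norm_real, Real.norm_eq_abs]
  have hprod : Summable fun p : ℕ × ℕ ↦ |c p.1| * |c p.2| :=
    hc.mul_of_nonneg hc (fun _ ↦ abs_nonneg _) fun _ ↦ abs_nonneg _
  have hF : ∀ θ : ℝ, HasSum (fun p : ℕ × ℕ ↦
      (c p.1 * c p.2 : ℂ) * Complex.exp (2 * ((p.1 - p.2 : ℤ) : ℂ) * Complex.I * θ))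
      ((‖g θ‖ ^ 2 : ℝ) : ℂ) := by
    intro θ
    have hconj := (Complex.hasSum_conj').2 (hg θ)
    have hmul := (hg θ).mul hconj (summable_mul_of_summable_norm
      (f := fun n : ℕ ↦ (c n : ℂ) * Complex.exp (2 * n * Complex.I * θ))
      (g := fun n : ℕ ↦ (starRingEnd ℂ) ((c n : ℂ) * Complex.exp (2 * n * Complex.I * θ)))
      (by simpa only [hcn] using hc) (by simpa only [RCLike.norm_conj, hcn] using hc))
    rw [Complex.mul_conj, Complex.normSq_eq_norm_sq] at hmul
    convert! hmul using 1
    funext p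
    simp only [map_mul, Complex.conj_ofReal, ← Complex.exp_conj, Complex.conj_I, map_natCast,
      map_ofNat]
    rw [mul_mul_mul_comm, ← Complex.exp_add]
    congr 2
    push_cast
    ring
  have hint := intervalIntegral.hasSum_integral_of_dominated_convergence (μ := MeasureTheory.volume)
    (a := 0) (b := π) (F := fun (p : ℕ × ℕ) (θ : ℝ) ↦
      (c p.1 * c p.2 : ℂ) * Complex.exp (2 * ((p.1 - p.2 : ℤ) : ℂ) * Complex.I * θ))
    (f := fun θ ↦ ((‖g θ‖ ^ 2 : ℝ) : ℂ))
    (fun p _ ↦ |c p.1| * |c p.2|)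
    (fun p ↦ (by fun_prop : Continuous _).aestronglyMeasurable)
    (fun p ↦ .of_forall fun θ _ ↦ by
      rw [norm_mul, show (2 * ((p.1 - p.2 : ℤ) : ℂ) * Complex.I * θ : ℂ)
        = ((2 * ((p.1 - p.2 : ℤ) : ℝ) * θ : ℝ) : ℂ) * Complex.I by push_cast; ring,
        Complex.norm_exp_ofReal_mul_I]
      simp)
    (.of_forall fun _ _ ↦ hprod) (by simp) (.of_forall fun θ _ ↦ hF θ)
  simp only [intervalIntegral.integral_const_mul, integral_exp_two_mul_int,
    intervalIntegral.integral_ofReal] at hint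
  have hdiag : Function.Injective fun n : ℕ ↦ (n, n) := fun a b h ↦ (Prod.mk.inj h).1
  rw [← hdiag.hasSum_iff] at hint
  · have hreal : HasSum (fun n ↦ π * c n ^ 2) (∫ θ in (0 : ℝ)..π, ‖g θ‖ ^ 2) := by
      rw [← Complex.hasSum_ofReal]
      convert! hint using 1
      funext n
      simp
      ring
    rw [← hreal.tsum_eq, tsum_mul_left]
  · rintro ⟨i, j⟩ hij
    have : (i : ℤ) - j ≠ 0 := by
      intro h
      exact hij ⟨i, by simp; omega⟩
    simp [this]

theorem integral_norm_one_add_mul_exp_inv {x : ℝ} (hx0 : 0 ≤ x) (hx1 : x < 1) :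
    ∫ θ in (0 : ℝ)..π, ‖1 + x * Complex.exp (2 * Complex.I * θ)‖⁻¹
      = π * ∑' n, dfr n ^ 2 * (x ^ 2) ^ n := by
  have hc : Summable fun n ↦ |dfr n * (-x) ^ n| := by
    refine .of_nonneg_of_le (fun _ ↦ abs_nonneg _) (fun n ↦ ?_)
      (summable_geometric_of_lt_one hx0 hx1)
    rw [abs_mul, abs_pow, abs_neg, abs_of_nonneg hx0, abs_of_nonneg (dfr_nonneg n)]
    exact mul_le_of_le_one_left (by positivity) (dfr_le_one n)
  have hexp : ∀ θ : ℝ, ‖Complex.exp (2 * Complex.I * θ)‖ = 1 := by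
    intro θ
    rw [show (2 * Complex.I * θ : ℂ) = ((2 * θ : ℝ) : ℂ) * Complex.I by push_cast; ring,
      Complex.norm_exp_ofReal_mul_I]
  have h := integral_norm_sq_eq_tsum hc
    (g := fun θ ↦ (1 + x * Complex.exp (2 * Complex.I * θ)) ^ (-1 / 2 : ℂ)) (by
      intro θ
      have := hasSum_dfr_mul_pow (z := -x * Complex.exp (2 * Complex.I * θ))
        (by simpa [hexp, abs_of_nonneg hx0] using hx1)
      rw [neg_mul, sub_neg_eq_add] at this
      convert! this using 1
      funext n
      rw [← neg_mul, mul_pow, ← Complex.exp_nat_mul]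
      push_cast
      rw [mul_assoc]
      congr 3
      ring)
  rw [show (fun n ↦ dfr n ^ 2 * (x ^ 2) ^ n) = fun n ↦ (dfr n * (-x) ^ n) ^ 2 by
    ext n; rw [mul_pow, pow_right_comm (-x), neg_sq], ← h]
  congr 1
  ext θ
  rw [show (-1 / 2 : ℂ) = ((-1 / 2 : ℝ) : ℂ) by push_cast; rfl, Complex.norm_cpow_real,
    ← Real.rpow_natCast, ← Real.rpow_mul (norm_nonneg _), ← Real.rpow_neg_one]
  norm_num

theorem integral_one_sub_mul_sin_sq_rpow {s : ℝ} (hs0 : 0 ≤ s) (hs1 : s < 1) :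
    ∫ θ in (0 : ℝ)..π, (1 - s * sin θ ^ 2) ^ (-1 / 2 : ℝ) = π * ∑' n, dfr n ^ 2 * s ^ n := by
  have hle : ∀ θ, s * sin θ ^ 2 ≤ s := fun θ ↦ mul_le_of_le_one_right hs0 (sin_sq_le_one θ)
  have hint := intervalIntegral.hasSum_integral_of_dominated_convergence (μ := MeasureTheory.volume)
    (a := 0) (b := π) (F := fun (n : ℕ) (θ : ℝ) ↦ dfr n * (s * sin θ ^ 2) ^ n)
    (f := fun θ ↦ (1 - s * sin θ ^ 2) ^ (-1 / 2 : ℝ))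
    (fun n _ ↦ s ^ n)
    (fun n ↦ (by fun_prop : Continuous _).aestronglyMeasurable)
    (fun n ↦ .of_forall fun θ _ ↦ by
      rw [Real.norm_of_nonneg (mul_nonneg (dfr_nonneg n) (by positivity))]
      exact (mul_le_of_le_one_left (by positivity) (dfr_le_one n)).trans
        (pow_le_pow_left₀ (by positivity) (hle θ) n))
    (.of_forall fun _ _ ↦ summable_geometric_of_lt_one hs0 hs1) (by simp)
    (.of_forall fun θ _ ↦ hasSum_dfr_mul_pow_real (by positivity) ((hle θ).trans_lt hs1))
  rw [← hint.tsum_eq, ← tsum_mul_left]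
  congr 1
  ext n
  simp only [mul_pow, ← pow_mul, intervalIntegral.integral_const_mul, integral_sin_pow_even,
    ← dfr_eq_prod]
  ring

/-- Landen's transformation for the series `∑ ((2n-1)‼ / (2n)‼)² sⁿ`. -/
theorem tsum_dfr_sq_landen {x : ℝ} (hx0 : 0 ≤ x) (hx1 : x < 1) :
    ∑' n, dfr n ^ 2 * (4 * x / (1 + x) ^ 2) ^ n = (1 + x) * ∑' n, dfr n ^ 2 * (x ^ 2) ^ n := by
  have hs0 : 0 ≤ 4 * x / (1 + x) ^ 2 := by positivity
  have hs1 : 4 * x / (1 + x) ^ 2 < 1 := by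
    rw [div_lt_one (by positivity)]
    nlinarith [sq_pos_of_pos (sub_pos.2 hx1)]
  have hnorm : ∀ θ : ℝ, ‖1 + x * Complex.exp (2 * Complex.I * θ)‖⁻¹
      = (1 + x)⁻¹ * (1 - 4 * x / (1 + x) ^ 2 * sin θ ^ 2) ^ (-1 / 2 : ℝ) := by
    intro θ
    have hnn : 0 ≤ 1 - 4 * x / (1 + x) ^ 2 * sin θ ^ 2 := by
      have := mul_le_of_le_one_right hs0 (sin_sq_le_one θ)
      linarith
    have hsq : ‖1 + x * Complex.exp (2 * Complex.I * θ)‖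
        = (1 + x) * √(1 - 4 * x / (1 + x) ^ 2 * sin θ ^ 2) := by
      rw [← sq_eq_sq₀ (norm_nonneg _) (by positivity), mul_pow, Real.sq_sqrt hnn,
        ← Complex.normSq_eq_norm_sq, show (2 * Complex.I * θ : ℂ)
          = ((2 * θ : ℝ) : ℂ) * Complex.I by push_cast; ring, Complex.exp_mul_I,
        ← Complex.ofReal_cos, ← Complex.ofReal_sin, Complex.normSq_apply]
      simp only [Complex.add_re, Complex.add_im, Complex.mul_re, Complex.mul_im, Complex.ofReal_re,
        Complex.ofReal_im, Complex.I_re, Complex.I_im, Complex.one_re, Complex.one_im]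
      rw [cos_two_mul, sin_two_mul]
      field_simp
      have := sin_sq_add_cos_sq θ
      have hc : cos θ ^ 2 = 1 - sin θ ^ 2 := by linarith
      ring_nf
      rw [show cos θ ^ 4 = (cos θ ^ 2) ^ 2 by ring, hc]
      ring
    rw [hsq, mul_inv, Real.sqrt_eq_rpow, ← Real.rpow_neg hnn]
    norm_num
  have h1 := integral_norm_one_add_mul_exp_inv hx0 hx1
  simp only [hnorm, intervalIntegral.integral_const_mul,
    integral_one_sub_mul_sin_sq_rpow hs0 hs1] at h1
  have hx : 1 + x ≠ 0 := by positivity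
  have := pi_ne_zero
  field_simp at h1
  rwa [mul_comm x 4] at h1

theorem continuousAt_tsum_dfr_sq : ContinuousAt (fun s : ℝ ↦ ∑' n, dfr n ^ 2 * s ^ n) 0 := by
  have : ContinuousOn (fun s : ℝ ↦ ∑' n, dfr n ^ 2 * s ^ n) (Set.Icc (-(1 / 2)) (1 / 2)) := by
    refine continuousOn_tsum (u := fun n ↦ (1 / 2 : ℝ) ^ n) (fun n ↦ by fun_prop)
      (summable_geometric_of_lt_one (by norm_num) (by norm_num)) fun n s hs ↦ ?_
    rw [norm_mul, norm_pow, norm_pow, Real.norm_of_nonneg (dfr_nonneg n)]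
    have h1 : ‖s‖ ≤ 1 / 2 := abs_le.2 hs
    exact (mul_le_of_le_one_left (by positivity) (pow_le_one₀ (dfr_nonneg n) (dfr_le_one n))).trans
      (pow_le_pow_left₀ (norm_nonneg _) h1 n)
  exact this.continuousAt (Icc_mem_nhds (by norm_num) (by norm_num))

/-- The arithmetic-geometric step preserves the value of the series, suitably normalized. -/
theorem tsum_dfr_sq_agm_step {u v : ℝ} (hv : 0 < v) (huv : v ≤ u) :
    (∑' n, dfr n ^ 2 * ((((u + v) / 2 - √(u * v)) / ((u + v) / 2 + √(u * v))) ^ 2) ^ n)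
        / (((u + v) / 2 + √(u * v)) / 2)
      = (∑' n, dfr n ^ 2 * (((u - v) / (u + v)) ^ 2) ^ n) / ((u + v) / 2) := by
  have hu : 0 < u := hv.trans_le huv
  set g := √(u * v) with hg
  have hg0 : 0 < g := Real.sqrt_pos.2 (by positivity)
  have hg2 : g ^ 2 = u * v := Real.sq_sqrt (by positivity)
  have hga : g ≤ (u + v) / 2 := by
    apply Real.sqrt_le_iff.2 ⟨by positivity, by nlinarith [sq_nonneg (u - v)]⟩
  set a := (u + v) / 2 with ha
  have ha0 : 0 < a := by positivity
  have hL := tsum_dfr_sq_landen (x := (a - g) / (a + g))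
    (div_nonneg (by linarith) (by positivity)) (by rw [div_lt_one (by positivity)]; linarith)
  have h1 : 1 + (a - g) / (a + g) = 2 * a / (a + g) := by field_simp; ring
  have hs : 4 * ((a - g) / (a + g)) / (1 + (a - g) / (a + g)) ^ 2 = ((u - v) / (u + v)) ^ 2 := by
    rw [h1, show u + v = 2 * a by rw [ha]; ring]
    have : (u - v) ^ 2 = 4 * (a ^ 2 - g ^ 2) := by rw [hg2, ha]; ring
    rw [div_pow (u - v), this]
    field_simp
    ring
  rw [hs, h1] at hL
  rw [hL]
  field_simp

theorem agmSeq_bounds {a b : ℝ} (hb : 0 < b) (hab : b ≤ a) (i : ℕ) :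
    b ≤ (agmSeq a b i).2 ∧ (agmSeq a b i).2 ≤ (agmSeq a b i).1 := by
  induction i with
  | zero => exact ⟨le_rfl, hab⟩
  | succ i ih =>
    obtain ⟨h1, h2⟩ := ih
    simp only [agmSeq]
    generalize (agmSeq a b i).1 = u at *
    generalize (agmSeq a b i).2 = v at *
    have hv : 0 < v := hb.trans_le h1
    refine ⟨h1.trans (Real.le_sqrt_of_sq_le (by nlinarith)), ?_⟩
    exact Real.sqrt_le_iff.2 ⟨by linarith, by nlinarith [sq_nonneg (u - v)]⟩

theorem agm_inv_eq_series (x : ℝ) (hx0 : 0 ≤ x) (hx1 : x < 1) (M : ℝ)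
    (hu : Tendsto (fun i => (agmSeq (1+x) (1-x) i).1) atTop (𝓝 M))
    (hv : Tendsto (fun i => (agmSeq (1+x) (1-x) i).2) atTop (𝓝 M)) :
    1 / M = ∑' j : ℕ, (dfr j)^2 * x^(2*j) := by
  have hb := agmSeq_bounds (a := 1 + x) (b := 1 - x) (by linarith) (by linarith)
  have hM : 0 < M :=
    (sub_pos.2 hx1).trans_le (ge_of_tendsto' hv fun i ↦ (hb i).1)
  set f : ℝ → ℝ := fun s ↦ ∑' n, dfr n ^ 2 * s ^ n with hf
  let G : ℝ × ℝ → ℝ := fun p ↦ f (((p.1 - p.2) / (p.1 + p.2)) ^ 2) / ((p.1 + p.2) / 2)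
  have hG : ∀ i, G (agmSeq (1 + x) (1 - x) i) = f (x ^ 2) := by
    intro i
    induction i with
    | zero =>
      simp only [G, agmSeq]
      ring_nf
    | succ i ih =>
      rw [← ih]
      exact tsum_dfr_sq_agm_step ((sub_pos.2 hx1).trans_le (hb i).1) (hb i).2
  have hf0 : f 0 = 1 := by
    rw [hf]
    simp only
    rw [tsum_eq_single 0 (fun n hn ↦ by simp [hn])]
    simp [dfr_zero]
  have hratio : Tendsto (fun i ↦ (((agmSeq (1 + x) (1 - x) i).1 - (agmSeq (1 + x) (1 - x) i).2)
      / ((agmSeq (1 + x) (1 - x) i).1 + (agmSeq (1 + x) (1 - x) i).2)) ^ 2) atTop (𝓝 0) := by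
    have := ((hu.sub hv).div (hu.add hv) (by positivity)).pow 2
    simpa using this
  have hlim : Tendsto (fun i ↦ G (agmSeq (1 + x) (1 - x) i)) atTop (𝓝 (f 0 / ((M + M) / 2))) :=
    (continuousAt_tsum_dfr_sq.tendsto.comp hratio).div ((hu.add hv).div_const 2) (by positivity)
  simp only [hG, hf0, add_self_div_two] at hlim
  simpa only [hf, pow_mul] using (tendsto_nhds_unique tendsto_const_nhds hlim).symm
end

section
/- For all real a, b > 0, if M is the common limit of the AGM sequences started from (a, b), then (2/π) · ∫₀^{π/2} (a² cos²θ + b² sin²θ)^{−1/2} dθ = 1/M. -/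
open Real Filter Topology

open MeasureTheory Set

lemma rpow_neg_half_eq_inv_sqrt {x : ℝ} (hx : 0 ≤ x) : x ^ (-(1/2) : ℝ) = (√x)⁻¹ := by
  rw [Real.rpow_neg hx, Real.sqrt_eq_rpow]

lemma image_const_mul_tan_Ioo {b : ℝ} (hb : 0 < b) :
    (fun θ => b * Real.tan θ) '' Ioo 0 (π / 2) = Ioi 0 := by
  ext t
  simp only [mem_image, mem_Ioo, mem_Ioi]
  constructor
  · rintro ⟨θ, ⟨h0, h1⟩, rfl⟩
    exact mul_pos hb (Real.tan_pos_of_pos_of_lt_pi_div_two h0 h1)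
  · intro ht
    refine ⟨Real.arctan (t / b), ⟨Real.arctan_pos.mpr (div_pos ht hb),
      Real.arctan_lt_pi_div_two _⟩, ?_⟩
    rw [Real.tan_arctan]
    field_simp

/-- The substitution `t = b tan θ` turns the elliptic integral into an algebraic one. -/
lemma integral_rpow_neg_half_eq_integral_Ioi {a b : ℝ} (hb : 0 < b) :
    ∫ θ in (0:ℝ)..(π/2), (a^2 * Real.cos θ ^ 2 + b^2 * Real.sin θ ^ 2) ^ (-(1/2) : ℝ) =
      ∫ t in Ioi (0:ℝ), (√((t^2 + a^2) * (t^2 + b^2)))⁻¹ := by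
  have hcos : ∀ θ ∈ Ioo 0 (π / 2), 0 < Real.cos θ := fun θ hθ =>
    Real.cos_pos_of_mem_Ioo ⟨by linarith [hθ.1, Real.pi_pos], hθ.2⟩
  rw [intervalIntegral.integral_of_le (by positivity), integral_Ioc_eq_integral_Ioo,
    ← image_const_mul_tan_Ioo hb,
    integral_image_eq_integral_abs_deriv_smul (f' := fun θ => b * (1 / Real.cos θ ^ 2))
      measurableSet_Ioo
      (fun θ hθ => ((Real.hasDerivAt_tan (hcos θ hθ).ne').const_mul b).hasDerivWithinAt)]
  · refine setIntegral_congr_fun measurableSet_Ioo fun θ hθ => ?_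
    have hc := hcos θ hθ
    have hsc := Real.sin_sq_add_cos_sq θ
    have hbc : 0 < b * (1 / Real.cos θ ^ 2) := by positivity
    have key : ((b * Real.tan θ)^2 + a^2) * ((b * Real.tan θ)^2 + b^2) =
        (b * (1 / Real.cos θ ^ 2))^2 * (a^2 * Real.cos θ ^ 2 + b^2 * Real.sin θ ^ 2) := by
      rw [Real.tan_eq_sin_div_cos]
      field_simp
      rw [hsc]
      ring
    simp only [smul_eq_mul]
    rw [rpow_neg_half_eq_inv_sqrt (by positivity), key, abs_of_pos hbc,
      Real.sqrt_mul (by positivity), Real.sqrt_sq hbc.le, mul_inv, mul_inv_cancel_left₀ hbc.ne']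
  · intro x hx y hy hxy
    exact Real.injOn_tan ⟨by linarith [hx.1, Real.pi_pos], hx.2⟩
      ⟨by linarith [hy.1, Real.pi_pos], hy.2⟩ (mul_left_cancel₀ hb.ne' hxy)

lemma image_half_sub_div_Ioi {c : ℝ} (hc : 0 < c) :
    (fun t => (t - c / t) / 2) '' Ioi 0 = univ := by
  refine eq_univ_of_forall fun x => ?_
  have hs := Real.sq_sqrt (show 0 ≤ x^2 + c by positivity)
  have hpos : 0 < x + √(x^2 + c) := by
    have : |x| < √(x^2 + c) := by
      rw [← Real.sqrt_sq_eq_abs]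
      exact Real.sqrt_lt_sqrt (sq_nonneg x) (by linarith)
    linarith [neg_abs_le x]
  refine ⟨x + √(x^2 + c), hpos, ?_⟩
  field_simp
  linear_combination hs

lemma injOn_half_sub_div_Ioi {c : ℝ} (hc : 0 < c) :
    InjOn (fun t => (t - c / t) / 2) (Ioi 0) := by
  intro t ht s hs h
  simp only [mem_Ioi] at ht hs
  have h' : (t - s) * (t * s + c) = 0 := by
    field_simp at h
    linear_combination h
  rcases mul_eq_zero.mp h' with h0 | h0
  · linarith
  · nlinarith [mul_pos ht hs]

/-- Gauss's invariance, through the substitution `x = (t - ab/t)/2`. -/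
lemma integral_Ioi_agm_step {a b : ℝ} (ha : 0 < a) (hb : 0 < b) :
    ∫ t in Ioi (0:ℝ), (√((t^2 + ((a + b) / 2)^2) * (t^2 + √(a * b)^2)))⁻¹ =
      ∫ t in Ioi (0:ℝ), (√((t^2 + a^2) * (t^2 + b^2)))⁻¹ := by
  have hab : 0 < a * b := mul_pos ha hb
  have heven := integral_comp_abs
    (f := fun t => (√((t^2 + ((a + b) / 2)^2) * (t^2 + √(a * b)^2)))⁻¹)
  simp only [sq_abs] at heven
  have hsubst : ∫ x, (√((x^2 + ((a + b) / 2)^2) * (x^2 + √(a * b)^2)))⁻¹ =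
      2 * ∫ t in Ioi (0:ℝ), (√((t^2 + a^2) * (t^2 + b^2)))⁻¹ := by
    rw [← setIntegral_univ, ← image_half_sub_div_Ioi hab,
      integral_image_eq_integral_abs_deriv_smul (f' := fun t => (1 + a * b / t^2) / 2)
        measurableSet_Ioi _ (injOn_half_sub_div_Ioi hab), ← integral_const_mul]
    · refine setIntegral_congr_fun measurableSet_Ioi fun t (ht : 0 < t) => ?_
      have hd : 0 < (1 + a * b / t^2) / 2 := by positivity
      have key : (((t - a * b / t) / 2)^2 + ((a + b) / 2)^2) *
          (((t - a * b / t) / 2)^2 + √(a * b)^2) =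
          ((1 + a * b / t^2) / 2 / 2)^2 * ((t^2 + a^2) * (t^2 + b^2)) := by
        rw [Real.sq_sqrt hab.le]
        field_simp
        ring
      simp only [smul_eq_mul]
      rw [key, abs_of_pos hd, Real.sqrt_mul (by positivity), Real.sqrt_sq (by positivity)]
      field_simp
    · intro t (ht : 0 < t)
      have h := (((hasDerivAt_id t).sub ((hasDerivAt_inv ht.ne').const_mul (a * b))).div_const 2)
      refine (h.congr_deriv ?_).hasDerivWithinAt
      field_simp
      ring
  linarith

lemma min_le_agmSeq {a b : ℝ} (ha : 0 < a) (hb : 0 < b) (i : ℕ) :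
    min a b ≤ (agmSeq a b i).1 ∧ min a b ≤ (agmSeq a b i).2 := by
  have hm : 0 < min a b := lt_min ha hb
  induction i with
  | zero => exact ⟨min_le_left a b, min_le_right a b⟩
  | succ i ih =>
    obtain ⟨h1, h2⟩ := ih
    refine ⟨?_, Real.le_sqrt_of_sq_le ?_⟩
    · simp only [agmSeq]
      linarith
    · nlinarith

lemma integral_agmSeq_eq {a b : ℝ} (ha : 0 < a) (hb : 0 < b) (i : ℕ) :
    ∫ θ in (0:ℝ)..(π/2), ((agmSeq a b i).1^2 * Real.cos θ ^ 2 +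
        (agmSeq a b i).2^2 * Real.sin θ ^ 2) ^ (-(1/2) : ℝ) =
      ∫ θ in (0:ℝ)..(π/2), (a^2 * Real.cos θ ^ 2 + b^2 * Real.sin θ ^ 2) ^ (-(1/2) : ℝ) := by
  have hpos : ∀ j, 0 < (agmSeq a b j).1 ∧ 0 < (agmSeq a b j).2 := fun j =>
    ⟨(lt_min ha hb).trans_le (min_le_agmSeq ha hb j).1,
      (lt_min ha hb).trans_le (min_le_agmSeq ha hb j).2⟩
  induction i with
  | zero => rfl
  | succ i ih =>
    rw [← ih, integral_rpow_neg_half_eq_integral_Ioi (hpos (i + 1)).2,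
      integral_rpow_neg_half_eq_integral_Ioi (hpos i).2]
    exact integral_Ioi_agm_step (hpos i).1 (hpos i).2

lemma tendsto_integral_rpow_neg_half {u v : ℕ → ℝ} {m M : ℝ} (hm : 0 < m)
    (hmu : ∀ i, m ≤ u i) (hmv : ∀ i, m ≤ v i)
    (hu : Tendsto u atTop (𝓝 M)) (hv : Tendsto v atTop (𝓝 M)) :
    Tendsto (fun i => ∫ θ in (0:ℝ)..(π/2),
      ((u i)^2 * Real.cos θ ^ 2 + (v i)^2 * Real.sin θ ^ 2) ^ (-(1/2) : ℝ)) atTop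
      (𝓝 (π / 2 * M⁻¹)) := by
  have hM : 0 < M := hm.trans_le (ge_of_tendsto' hu hmu)
  have hlow : ∀ i θ, m^2 ≤ (u i)^2 * Real.cos θ ^ 2 + (v i)^2 * Real.sin θ ^ 2 := by
    intro i θ
    calc m^2 = m^2 * Real.cos θ ^ 2 + m^2 * Real.sin θ ^ 2 := by
          linear_combination (-m^2) * Real.sin_sq_add_cos_sq θ
      _ ≤ _ := by
          gcongr
          · exact hmu i
          · exact hmv i
  have hconst : π / 2 * M⁻¹ = ∫ _θ in (0:ℝ)..(π/2), M⁻¹ := by simp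
  rw [hconst]
  refine intervalIntegral.tendsto_integral_filter_of_dominated_convergence (fun _ => m⁻¹)
    (.of_forall fun i => ?_) (.of_forall fun i => .of_forall fun θ _ => ?_)
    intervalIntegrable_const (.of_forall fun θ _ => ?_)
  · exact Measurable.aestronglyMeasurable (by fun_prop)
  · have h := hlow i θ
    have hsq : m ≤ √((u i)^2 * Real.cos θ ^ 2 + (v i)^2 * Real.sin θ ^ 2) :=
      Real.le_sqrt_of_sq_le h
    rw [rpow_neg_half_eq_inv_sqrt (by positivity), Real.norm_of_nonneg (by positivity)]
    gcongr
  · have hlim : Tendsto (fun i => (u i)^2 * Real.cos θ ^ 2 + (v i)^2 * Real.sin θ ^ 2) atTop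
        (𝓝 (M^2 * Real.cos θ ^ 2 + M^2 * Real.sin θ ^ 2)) :=
      ((hu.pow 2).mul_const _).add ((hv.pow 2).mul_const _)
    rw [← mul_add, Real.cos_sq_add_sin_sq, mul_one] at hlim
    have h := hlim.rpow_const (p := -(1/2)) (Or.inl (by positivity))
    rwa [rpow_neg_half_eq_inv_sqrt (sq_nonneg M), Real.sqrt_sq hM.le] at h

theorem agm_inv_eq_integral (a b : ℝ) (ha : 0 < a) (hb : 0 < b) (M : ℝ)
    (hu : Tendsto (fun i => (agmSeq a b i).1) atTop (𝓝 M))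
    (hv : Tendsto (fun i => (agmSeq a b i).2) atTop (𝓝 M)) :
    (2/π) * ∫ θ in (0:ℝ)..(π/2),
        (a^2 * Real.cos θ ^ 2 + b^2 * Real.sin θ ^ 2) ^ (-(1/2) : ℝ) = 1 / M := by
  have h := tendsto_integral_rpow_neg_half (lt_min ha hb) (fun i => (min_le_agmSeq ha hb i).1)
    (fun i => (min_le_agmSeq ha hb i).2) hu hv
  simp only [integral_agmSeq_eq ha hb] at h
  rw [tendsto_nhds_unique tendsto_const_nhds h]
  field_simp
end

section
/- Let n ≥ 1 be a natural number, let Pₙ be the n-th Legendre polynomial, let x₁, …, xₙ ∈ (−1, 1) be the n pairwise distinct roots of Pₙ, and set wᵢ = 2/((1 − xᵢ²)·Pₙ′(xᵢ)²). Then for every f : ℝ → ℝ that is 2n times continuously differentiable on [−1, 1], there exists η ∈ (−1, 1) such that ∫_{−1}^{1} f(x) dx = Σ_{i=1}^{n} wᵢ f(xᵢ) + ((n!)⁴/((2n)!)³) · (2^{2n+1}/(2n+1)) · f^{(2n)}(η). -/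
open Real

/-- The `n`-th Legendre polynomial via the Rodrigues formula. -/
noncomputable def legendre (n : ℕ) (x : ℝ) : ℝ :=
  (1 / (2^n * (Nat.factorial n : ℝ))) * iteratedDeriv n (fun y : ℝ => (y^2 - 1)^n) x

open Polynomial in
/-- The `n`-th Legendre polynomial as a formal polynomial. -/
noncomputable def legendrePoly (n : ℕ) : ℝ[X] :=
  C (1 / (2 ^ n * (Nat.factorial n : ℝ))) * derivative^[n] ((X ^ 2 - 1) ^ n)

namespace LegendrePoly

open Polynomial Set

/-- Rolle's theorem on a finite set of zeros: one fewer critical points, interlacing the zeros. -/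
lemma exists_finset_deriv_eq_zero {a b : ℝ} {g : ℝ → ℝ} (hg : ContinuousOn g (Ioo a b))
    {S : Finset ℝ} {m : ℕ} (hS : ∀ s ∈ S, s ∈ Ioo a b) (h0 : ∀ s ∈ S, g s = 0)
    (hcard : S.card = m + 1) :
    ∃ T : Finset ℝ, T.card = m ∧ Disjoint T S ∧ (∀ t ∈ T, t ∈ Ioo a b) ∧
      ∀ t ∈ T, deriv g t = 0 := by
  set s := S.orderEmbOfFin hcard with hs
  have hmem : ∀ i, s i ∈ S := fun i => S.orderEmbOfFin_mem hcard i
  have hrolle : ∀ i : Fin m, ∃ c ∈ Ioo (s i.castSucc) (s i.succ), deriv g c = 0 := by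
    intro i
    refine exists_deriv_eq_zero (s.strictMono i.castSucc_lt_succ) (hg.mono ?_) ?_
    · exact fun y hy => ⟨(hS _ (hmem _)).1.trans_le hy.1, hy.2.trans_lt (hS _ (hmem _)).2⟩
    · rw [h0 _ (hmem _), h0 _ (hmem _)]
  choose c hc hc0 using hrolle
  have hcmono : StrictMono c := by
    intro i j hij
    refine (hc i).2.trans_le (le_trans (s.monotone ?_) (hc j).1.le)
    rw [Fin.le_def]
    simpa using hij
  refine ⟨Finset.univ.image c, ?_, ?_, ?_, ?_⟩
  · rw [Finset.card_image_of_injective _ hcmono.injective]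
    simp
  · rw [Finset.disjoint_left]
    intro y hy hyS
    obtain ⟨i, -, rfl⟩ := Finset.mem_image.mp hy
    have hrange : c i ∈ Set.range s := by
      rw [hs, Finset.range_orderEmbOfFin]
      exact hyS
    obtain ⟨j, hj⟩ := hrange
    have h1 := hc i
    rw [← hj] at h1
    have h2 := s.lt_iff_lt.mp h1.1
    have h3 := s.lt_iff_lt.mp h1.2
    rw [Fin.lt_def] at h2 h3
    simp at h2 h3
    omega
  · intro y hy
    obtain ⟨i, -, rfl⟩ := Finset.mem_image.mp hy
    exact ⟨(hS _ (hmem _)).1.trans (hc i).1, (hc i).2.trans (hS _ (hmem _)).2⟩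
  · intro y hy
    obtain ⟨i, -, rfl⟩ := Finset.mem_image.mp hy
    exact hc0 i

lemma exists_iteratedDeriv_eq_zero {a b : ℝ} (k : ℕ) {g : ℝ → ℝ}
    (hg : ContDiffOn ℝ k g (Ioo a b)) {S : Finset ℝ} (hS : ∀ s ∈ S, s ∈ Ioo a b)
    (h0 : ∀ s ∈ S, g s = 0) (hcard : S.card = k + 1) :
    ∃ ξ ∈ Ioo a b, iteratedDeriv k g ξ = 0 := by
  induction k generalizing g S with
  | zero =>
    obtain ⟨s, hs⟩ := Finset.card_pos.mp (by omega : 0 < S.card)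
    exact ⟨s, hS s hs, by simpa using h0 s hs⟩
  | succ k ih =>
    obtain ⟨T, hT, -, hTmem, hT0⟩ := exists_finset_deriv_eq_zero hg.continuousOn hS h0 hcard
    rw [iteratedDeriv_succ']
    exact ih (hg.deriv_of_isOpen isOpen_Ioo (by norm_cast)) hTmem hT0 hT

/-- A function with `n` double zeros and one further zero has a zero of its derivative of
order `2 * n`. -/
lemma exists_iteratedDeriv_two_mul_eq_zero {a b : ℝ} {n : ℕ} (hn : 1 ≤ n) {g : ℝ → ℝ}
    (hg : ContDiffOn ℝ (2 * n : ℕ) g (Ioo a b)) {x : Fin n → ℝ} (hinj : Function.Injective x)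
    (hmem : ∀ i, x i ∈ Ioo a b) (h0 : ∀ i, g (x i) = 0) (h1 : ∀ i, deriv g (x i) = 0)
    {y : ℝ} (hy : y ∈ Ioo a b) (hyx : ∀ i, x i ≠ y) (hgy : g y = 0) :
    ∃ ξ ∈ Ioo a b, iteratedDeriv (2 * n) g ξ = 0 := by
  classical
  have hcardx : (Finset.univ.image x).card = n := by
    rw [Finset.card_image_of_injective _ hinj]
    simp
  obtain ⟨T, hT, hdisj, hTmem, hT0⟩ := exists_finset_deriv_eq_zero (m := n) hg.continuousOn
    (S := insert y (Finset.univ.image x))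
    (by simpa [-mem_Ioo] using ⟨hy, hmem⟩)
    (by simpa using ⟨hgy, h0⟩)
    (by rw [Finset.card_insert_of_notMem (by simpa using hyx), hcardx])
  have hdisj' : Disjoint T (Finset.univ.image x) := by
    rw [Finset.disjoint_insert_right] at hdisj
    exact hdisj.2
  obtain ⟨k, hk⟩ : ∃ k, 2 * n = k + 1 := ⟨2 * n - 1, by omega⟩
  rw [hk] at hg ⊢
  rw [iteratedDeriv_succ']
  refine exists_iteratedDeriv_eq_zero k (hg.deriv_of_isOpen isOpen_Ioo (by norm_cast))
    (S := T ∪ Finset.univ.image x) ?_ ?_ ?_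
  · intro s hs
    rcases Finset.mem_union.mp hs with hs | hs
    · exact hTmem s hs
    · obtain ⟨i, -, rfl⟩ := Finset.mem_image.mp hs
      exact hmem i
  · intro s hs
    rcases Finset.mem_union.mp hs with hs | hs
    · exact hT0 s hs
    · obtain ⟨i, -, rfl⟩ := Finset.mem_image.mp hs
      exact h1 i
  · rw [Finset.card_union_of_disjoint hdisj', hT, hcardx]
    omega

lemma iteratedDeriv_eval (p : ℝ[X]) (k : ℕ) :
    iteratedDeriv k (fun y => p.eval y) = fun y => (derivative^[k] p).eval y := by
  induction k with
  | zero => simp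
  | succ k ih =>
    rw [iteratedDeriv_succ, ih, Function.iterate_succ_apply']
    ext y
    exact Polynomial.deriv _

lemma legendre_eq_eval (n : ℕ) : legendre n = fun y => (legendrePoly n).eval y := by
  ext y
  have h : (fun y : ℝ => (y ^ 2 - 1) ^ n) = fun y => ((X ^ 2 - 1 : ℝ[X]) ^ n).eval y := by
    ext y; simp
  simp only [legendre, legendrePoly]
  rw [h, iteratedDeriv_eval]
  simp

lemma eval_iterate_derivative_X_sub_C_pow_mul (n : ℕ) (a : ℝ) (q : ℝ[X]) :
    (derivative^[n] ((X - C a) ^ n * q)).eval a = n.factorial * q.eval a := by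
  induction n generalizing q with
  | zero => simp
  | succ n ih =>
    have h : derivative ((X - C a) ^ (n + 1) * q)
        = (X - C a) ^ n * (C ((n : ℝ) + 1) * q + (X - C a) * derivative q) := by
      rw [derivative_mul, derivative_X_sub_C_pow]
      simp
      ring
    rw [Function.iterate_succ_apply, h, ih]
    simp [Nat.factorial_succ]
    ring

lemma X_sq_sub_one_pow (n : ℕ) :
    ((X ^ 2 - 1 : ℝ[X]) ^ n) = (X - C 1) ^ n * (X + 1) ^ n := by
  rw [← mul_pow]; congr 1; simp; ring

lemma X_sq_sub_one_pow' (n : ℕ) :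
    ((X ^ 2 - 1 : ℝ[X]) ^ n) = (X - C (-1)) ^ n * (X - 1) ^ n := by
  rw [← mul_pow]; congr 1; simp; ring

lemma eval_one (n : ℕ) : (legendrePoly n).eval 1 = 1 := by
  rw [legendrePoly, eval_mul, X_sq_sub_one_pow, eval_iterate_derivative_X_sub_C_pow_mul]
  have : (n.factorial : ℝ) ≠ 0 := by positivity
  simp
  field_simp
  norm_num

lemma eval_neg_one (n : ℕ) : (legendrePoly n).eval (-1) = (-1) ^ n := by
  rw [legendrePoly, eval_mul, X_sq_sub_one_pow', eval_iterate_derivative_X_sub_C_pow_mul]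
  have : (n.factorial : ℝ) ≠ 0 := by positivity
  have h2 : (-1 - 1 : ℝ) ^ n = (-1) ^ n * 2 ^ n := by rw [← mul_pow]; norm_num
  simp [h2]
  field_simp

lemma natDegree_X_sq_sub_one_pow (n : ℕ) : ((X ^ 2 - 1 : ℝ[X]) ^ n).natDegree = n * 2 := by
  rw [natDegree_pow]
  congr 1
  compute_degree!

lemma natDegree_le (n : ℕ) : (legendrePoly n).natDegree ≤ n := by
  refine (natDegree_C_mul_le _ _).trans ((natDegree_iterate_derivative _ _).trans ?_)
  rw [natDegree_X_sq_sub_one_pow]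
  omega

lemma coeff_self (n : ℕ) :
    (legendrePoly n).coeff n = ((2 * n).factorial : ℝ) / (2 ^ n * (n.factorial : ℝ) ^ 2) := by
  have h1 : ((X ^ 2 - 1 : ℝ[X]) ^ n).coeff (n + n) = 1 := by
    have h := coeff_pow_of_natDegree_le (p := (X ^ 2 - 1 : ℝ[X])) (m := n) (n := 2)
      (by compute_degree!)
    rw [mul_two] at h
    rw [h]
    simp [coeff_one]
  have h2 : (n.factorial : ℝ) * ((n + n).descFactorial n : ℝ) = ((2 * n).factorial : ℝ) := by
    have := Nat.factorial_mul_descFactorial (n := n + n) (k := n) (by omega)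
    rw [Nat.add_sub_cancel] at this
    rw [two_mul]
    exact_mod_cast this
  have : (n.factorial : ℝ) ≠ 0 := by positivity
  rw [legendrePoly, coeff_C_mul, coeff_iterate_derivative, h1, ← h2]
  simp
  field_simp

lemma coeff_self_pos (n : ℕ) : 0 < (legendrePoly n).coeff n := by
  rw [coeff_self]; positivity

lemma degree_eq (n : ℕ) : (legendrePoly n).degree = n :=
  le_antisymm (natDegree_le_iff_degree_le.mp (natDegree_le n))
    (le_degree_of_ne_zero (coeff_self_pos n).ne')

lemma ne_zero (n : ℕ) : legendrePoly n ≠ 0 := fun h => by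
  simpa [h] using coeff_self_pos n

lemma iterate_derivative_sq (n : ℕ) :
    derivative^[2 * n] ((legendrePoly n) ^ 2)
      = C (((2 * n).factorial : ℝ) * (legendrePoly n).coeff n ^ 2) := by
  have hd : (derivative^[2 * n] ((legendrePoly n) ^ 2)).natDegree ≤ 0 := by
    refine (natDegree_iterate_derivative _ _).trans ?_
    have := natDegree_pow_le (p := legendrePoly n) (n := 2)
    have := natDegree_le n
    omega
  rw [eq_C_of_natDegree_le_zero hd, coeff_iterate_derivative, zero_add,
    coeff_pow_of_natDegree_le (natDegree_le n), Nat.descFactorial_self, nsmul_eq_mul]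

lemma intervalIntegrable (p : ℝ[X]) (a b : ℝ) :
    IntervalIntegrable (fun t => p.eval t) MeasureTheory.volume a b :=
  p.continuous.intervalIntegrable a b

lemma integral_add (p q : ℝ[X]) (a b : ℝ) :
    ∫ t in a..b, (p + q).eval t = (∫ t in a..b, p.eval t) + ∫ t in a..b, q.eval t := by
  simp only [eval_add]
  exact intervalIntegral.integral_add (intervalIntegrable p a b) (intervalIntegrable q a b)

lemma integral_C_mul (c : ℝ) (p : ℝ[X]) (a b : ℝ) :
    ∫ t in a..b, (C c * p).eval t = c * ∫ t in a..b, p.eval t := by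
  simp

lemma integral_derivative (p : ℝ[X]) (a b : ℝ) :
    ∫ t in a..b, (derivative p).eval t = p.eval b - p.eval a :=
  intervalIntegral.integral_eq_sub_of_hasDerivAt (fun t _ => p.hasDerivAt t)
    (intervalIntegrable _ a b)

/-- Repeated integration by parts against a polynomial of degree less than `k`, when the boundary
terms vanish. -/
lemma integral_iterate_derivative_mul_eq_zero (a b : ℝ) (W : ℝ[X]) (k : ℕ)
    (ha : ∀ j < k, (derivative^[j] W).eval a = 0) (hb : ∀ j < k, (derivative^[j] W).eval b = 0)
    (Q : ℝ[X]) (hQ : Q.degree < k) :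
    ∫ t in a..b, (derivative^[k] W * Q).eval t = 0 := by
  induction k generalizing Q with
  | zero =>
    have : Q = 0 := degree_eq_bot.mp (by simpa using hQ)
    simp [this]
  | succ k ih =>
    have hQ' : (derivative Q).degree < k := by
      by_cases h0 : Q = 0
      · simp [h0]
      · refine (degree_derivative_lt h0).trans_le ?_
        rw [degree_eq_natDegree h0] at hQ ⊢
        norm_cast at hQ ⊢
        omega
    have h := integral_derivative (derivative^[k] W * Q) a b
    rw [derivative_mul, integral_add, ih (fun j hj => ha j (by omega))
      (fun j hj => hb j (by omega)) _ hQ', eval_mul, eval_mul, ha k (by omega),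
      hb k (by omega)] at h
    rw [Function.iterate_succ_apply']
    simpa using h

lemma eval_iterate_derivative_eq_zero_of_dvd {p : ℝ[X]} {a : ℝ} {n j : ℕ} (hj : j < n)
    (h : (X - C a) ^ n ∣ p) : (derivative^[j] p).eval a = 0 := by
  have h1 := pow_sub_dvd_iterate_derivative_of_pow_dvd j h
  exact dvd_iff_isRoot.mp ((dvd_pow_self _ (by omega)).trans h1)

lemma integral_mul_eq_zero (n : ℕ) (Q : ℝ[X]) (hQ : Q.degree < n) :
    ∫ t in (-1 : ℝ)..1, (legendrePoly n * Q).eval t = 0 := by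
  rw [legendrePoly, mul_assoc, integral_C_mul, integral_iterate_derivative_mul_eq_zero _ _ _ _
    (fun j hj => eval_iterate_derivative_eq_zero_of_dvd hj
      (X_sq_sub_one_pow' n ▸ dvd_mul_right _ _))
    (fun j hj => eval_iterate_derivative_eq_zero_of_dvd hj
      (X_sq_sub_one_pow n ▸ dvd_mul_right _ _)) Q hQ, mul_zero]

lemma integral_sq (n : ℕ) :
    ∫ t in (-1 : ℝ)..1, ((legendrePoly n) ^ 2).eval t = 2 / (2 * n + 1) := by
  set P := legendrePoly n with hP
  have hlow : (X * derivative P - C (n : ℝ) * P).degree < (n : WithBot ℕ) := by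
    rw [degree_lt_iff_coeff_zero]
    intro m hm
    have hXP : ∀ m, (X * derivative P).coeff m = m * P.coeff m := by
      intro m
      cases m with
      | zero => simp
      | succ m => rw [coeff_X_mul, coeff_derivative]; push_cast; ring
    rw [coeff_sub, hXP, coeff_C_mul]
    rcases hm.eq_or_lt with rfl | hlt
    · ring
    · rw [coeff_eq_zero_of_natDegree_lt ((natDegree_le n).trans_lt hlt)]
      ring
  have h0 := integral_mul_eq_zero n _ hlow
  have h := integral_derivative (X * P ^ 2) (-1) 1
  have he : derivative (X * P ^ 2)
      = C (2 * (n : ℝ) + 1) * P ^ 2 + C 2 * (P * (X * derivative P - C (n : ℝ) * P)) := by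
    rw [derivative_mul, derivative_X, derivative_sq]
    simp only [C_add, C_mul, map_one]
    ring
  have hsq : ((-1 : ℝ) ^ n) ^ 2 = 1 := by rw [← pow_mul, mul_comm, pow_mul]; norm_num
  rw [he, integral_add, integral_C_mul, integral_C_mul, h0, eval_mul, eval_mul, eval_pow, eval_pow,
    eval_one, eval_neg_one, hsq] at h
  have : (2 * (n : ℝ) + 1) ≠ 0 := by positivity
  rw [eq_div_iff this]
  simp at h
  simp
  linarith

variable {n : ℕ}

lemma eval_ne_zero {x : Fin n → ℝ} (hroot : ∀ i, (legendrePoly n).eval (x i) = 0)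
    (hinj : Function.Injective x) {y : ℝ} (hy : ∀ i, x i ≠ y) :
    (legendrePoly n).eval y ≠ 0 := by
  classical
  intro h
  refine ne_zero n (eq_zero_of_natDegree_lt_card_of_eval_eq_zero' _
    (insert y (Finset.univ.image x)) ?_ ?_)
  · intro z hz
    rcases Finset.mem_insert.mp hz with rfl | hz
    · exact h
    · obtain ⟨i, -, rfl⟩ := Finset.mem_image.mp hz
      exact hroot i
  · rw [Finset.card_insert_of_notMem (by simpa using hy), Finset.card_image_of_injective _ hinj]
    simpa using Nat.lt_succ_of_le (natDegree_le n)

/-- Exactness of the interpolatory quadrature at the roots in degrees less than `2 * n`. -/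
lemma integral_eq_sum_basis {x : Fin n → ℝ} (hroot : ∀ i, (legendrePoly n).eval (x i) = 0)
    (hinj : Function.Injective x) (R : ℝ[X]) (hR : R.degree < (2 * n : ℕ)) :
    ∫ t in (-1 : ℝ)..1, R.eval t
      = ∑ i, (∫ t in (-1 : ℝ)..1, (Lagrange.basis Finset.univ x i).eval t) * R.eval (x i) := by
  have hdm : legendrePoly n * (R / legendrePoly n) + R % legendrePoly n = R :=
    EuclideanDomain.div_add_mod R (legendrePoly n)
  have hmod : (R % legendrePoly n).degree < n :=
    (degree_mod_lt R (ne_zero n)).trans_eq (degree_eq n)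
  have hdiv : (R / legendrePoly n).degree < n := by
    by_cases hq : R / legendrePoly n = 0
    · simp [hq]
    have hle : (legendrePoly n).degree ≤ R.degree := by
      by_contra! hlt
      exact hq ((Polynomial.div_eq_zero_iff (ne_zero n)).mpr hlt)
    have h := degree_add_div (ne_zero n) hle
    rw [← h, degree_eq, degree_eq_natDegree hq] at hR
    rw [degree_eq_natDegree hq]
    norm_cast at hR ⊢
    omega
  have hev : ∀ i, (R % legendrePoly n).eval (x i) = R.eval (x i) := by
    intro i
    conv_rhs => rw [← hdm]
    rw [eval_add, eval_mul, hroot i]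
    ring
  have hint : R % legendrePoly n = ∑ i, C (R.eval (x i)) * Lagrange.basis Finset.univ x i := by
    have h := Lagrange.eq_interpolate (s := Finset.univ) (v := x) hinj.injOn
      (f := R % legendrePoly n) (by simpa using hmod)
    rw [Lagrange.interpolate_apply] at h
    simpa only [hev] using h
  conv_lhs => rw [← hdm]
  rw [integral_add, integral_mul_eq_zero n _ hdiv, zero_add, hint]
  simp only [eval_finsetSum]
  rw [intervalIntegral.integral_finsetSum (fun i _ => intervalIntegrable _ _ _)]
  exact Finset.sum_congr rfl fun i _ => by rw [integral_C_mul, mul_comm]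

lemma integral_basis_mul_sq {x : Fin n → ℝ} (hmem : ∀ i, x i ∈ Set.Ioo (-1 : ℝ) 1)
    (hroot : ∀ i, (legendrePoly n).eval (x i) = 0) (hinj : Function.Injective x) (i : Fin n) :
    (∫ t in (-1 : ℝ)..1, (Lagrange.basis Finset.univ x i).eval t)
      * (derivative (legendrePoly n)).eval (x i) ^ 2 = 2 / (1 - x i ^ 2) := by
  obtain ⟨L, hL⟩ := dvd_iff_isRoot.mpr (hroot i)
  have hPd : derivative (legendrePoly n) = L + (X - C (x i)) * derivative L := by
    conv_lhs => rw [hL]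
    simp
  have hLi : L.eval (x i) = (derivative (legendrePoly n)).eval (x i) := by simp [hPd]
  have hLj : ∀ j, j ≠ i → L.eval (x j) = 0 := by
    intro j hj
    have h := hroot j
    rw [hL] at h
    simp only [eval_mul, eval_sub, eval_X, eval_C, mul_eq_zero] at h
    exact h.resolve_left (sub_ne_zero.mpr (hinj.ne hj))
  have hn : 0 < n := i.pos
  have hL0 : L ≠ 0 := by
    rintro rfl
    exact ne_zero n (by rw [hL, mul_zero])
  have hLdeg : L.natDegree + 1 = n := by
    have h := natDegree_eq_of_degree_eq_some (degree_eq n)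
    rw [hL, natDegree_mul (X_sub_C_ne_zero _) hL0, natDegree_X_sub_C] at h
    omega
  have hPdeg : (derivative (legendrePoly n)).natDegree + 1 ≤ n := by
    have := natDegree_derivative_le (legendrePoly n)
    have := natDegree_le n
    omega
  have hd : derivative ((X - C (x i)) * L ^ 2) = C 2 * (derivative (legendrePoly n) * L) - L ^ 2 := by
    rw [derivative_mul, derivative_sq, hPd, derivative_X_sub_C, C_ofNat]
    ring
  have hdeg : (C 2 * (derivative (legendrePoly n) * L) - L ^ 2).degree
      < ((2 * n : ℕ) : WithBot ℕ) := by
    refine degree_le_natDegree.trans_lt ?_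
    have h1 : (C 2 * (derivative (legendrePoly n) * L)).natDegree ≤ 2 * n - 1 := by
      refine (natDegree_C_mul_le _ _).trans (natDegree_mul_le.trans ?_)
      omega
    have h2 : (L ^ 2).natDegree ≤ 2 * n - 1 := natDegree_pow_le.trans (by omega)
    have h3 := (natDegree_sub_le _ _).trans (max_le h1 h2)
    norm_cast
    omega
  have hI := integral_derivative ((X - C (x i)) * L ^ 2) (-1) 1
  rw [hd, integral_eq_sum_basis hroot hinj _ hdeg, Finset.sum_eq_single i] at hI
  · obtain ⟨h1, h2⟩ := hmem i
    have e1 : (1 - x i) * L.eval 1 = 1 := by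
      have := eval_one n
      rw [hL] at this
      simpa using this
    have e2 : (-1 - x i) * L.eval (-1) = (-1) ^ n := by
      have := eval_neg_one n
      rw [hL] at this
      simpa using this
    have hsq : ((-1 : ℝ) ^ n) ^ 2 = 1 := by rw [← pow_mul, mul_comm, pow_mul]; norm_num
    rw [← e2] at hsq
    simp only [eval_sub, eval_mul, eval_pow, eval_C, eval_X, hLi] at hI
    have hne : (1 - x i ^ 2) ≠ 0 := by nlinarith
    rw [eq_div_iff hne]
    have e3 : (1 - x i) ^ 2 * L.eval 1 ^ 2 = 1 := by rw [← mul_pow, e1]; norm_num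
    linear_combination (1 - x i ^ 2) * hI + (1 + x i) * e3 + (1 - x i) * hsq
  · intro j _ hj
    simp [hLj j hj]
  · simp

lemma contDiff_eval (p : ℝ[X]) (k : ℕ) : ContDiff ℝ k fun t => p.eval t := by
  simpa using p.contDiff_aeval (𝕜 := ℝ) (n := k)

lemma iteratedDeriv_sub_eval {U : Set ℝ} (hU : IsOpen U) {k : ℕ} {g : ℝ → ℝ}
    (hg : ContDiffOn ℝ k g U) (p : ℝ[X]) {y : ℝ} (hy : y ∈ U) :
    iteratedDeriv k (fun t => g t - p.eval t) y
      = iteratedDeriv k g y - (derivative^[k] p).eval y := by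
  rw [iteratedDeriv_fun_sub (hg.contDiffAt (hU.mem_nhds hy)) (contDiff_eval p k).contDiffAt,
    iteratedDeriv_eval]

variable {x : Fin n → ℝ} {F : ℝ → ℝ}

lemma pos_of_iteratedDeriv_pos (hn : 1 ≤ n) (hmem : ∀ i, x i ∈ Ioo (-1 : ℝ) 1)
    (hroot : ∀ i, (legendrePoly n).eval (x i) = 0) (hinj : Function.Injective x)
    (hF : ContDiffOn ℝ (2 * n : ℕ) F (Ioo (-1 : ℝ) 1))
    (h0 : ∀ i, F (x i) = 0) (h1 : ∀ i, deriv F (x i) = 0)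
    (hpos : ∀ y ∈ Ioo (-1 : ℝ) 1, 0 < iteratedDeriv (2 * n) F y)
    {y : ℝ} (hy : y ∈ Ioo (-1 : ℝ) 1) (hyx : ∀ i, x i ≠ y) : 0 < F y := by
  have hPy : (legendrePoly n).eval y ≠ 0 := eval_ne_zero hroot hinj hyx
  set c := F y / (legendrePoly n).eval y ^ 2 with hc
  have hFd : ∀ i, DifferentiableAt ℝ F (x i) := fun i =>
    (hF.contDiffAt (isOpen_Ioo.mem_nhds (hmem i))).differentiableAt
      (by norm_cast; omega)
  obtain ⟨ξ, hξ, hξ0⟩ := exists_iteratedDeriv_two_mul_eq_zero hn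
    (g := fun t => F t - (C c * legendrePoly n ^ 2).eval t)
    (hF.sub (contDiff_eval _ _).contDiffOn) hinj hmem
    (fun i => by simp [h0, hroot])
    (fun i => by
      rw [deriv_fun_sub (hFd i) (Polynomial.differentiableAt _), h1, Polynomial.deriv]
      simp [derivative_sq, hroot])
    hy hyx
    (by
      simp only [eval_mul, eval_C, eval_pow, hc]
      field_simp
      ring)
  rw [iteratedDeriv_sub_eval isOpen_Ioo hF _ hξ, iterate_derivative_C_mul, iterate_derivative_sq,
    eval_mul, eval_C, eval_C, sub_eq_zero] at hξ0
  have hK : 0 < ((2 * n).factorial : ℝ) * (legendrePoly n).coeff n ^ 2 := by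
    have := coeff_self_pos n
    positivity
  have hcpos : 0 < c := by
    have h := hpos ξ hξ
    rw [hξ0] at h
    exact pos_of_mul_pos_left h hK.le
  have hFy : F y = c * (legendrePoly n).eval y ^ 2 := by
    rw [hc]
    field_simp
  rw [hFy]
  positivity

lemma integral_pos_of_iteratedDeriv_pos (hn : 1 ≤ n) (hmem : ∀ i, x i ∈ Ioo (-1 : ℝ) 1)
    (hroot : ∀ i, (legendrePoly n).eval (x i) = 0) (hinj : Function.Injective x)
    (hFc : ContinuousOn F (Icc (-1 : ℝ) 1))
    (hF : ContDiffOn ℝ (2 * n : ℕ) F (Ioo (-1 : ℝ) 1))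
    (h0 : ∀ i, F (x i) = 0) (h1 : ∀ i, deriv F (x i) = 0)
    (hpos : ∀ y ∈ Ioo (-1 : ℝ) 1, 0 < iteratedDeriv (2 * n) F y) :
    0 < ∫ t in (-1 : ℝ)..1, F t := by
  classical
  have hy : ∀ y ∈ Ioo (-1 : ℝ) 1, (∀ i, x i ≠ y) → 0 < F y := fun y hy hyx =>
    pos_of_iteratedDeriv_pos hn hmem hroot hinj hF h0 h1 hpos hy hyx
  have hnonneg : ∀ y ∈ Ioo (-1 : ℝ) 1, 0 ≤ F y := by
    intro y hyI
    by_cases hyx : ∀ i, x i ≠ y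
    · exact (hy y hyI hyx).le
    · push Not at hyx
      obtain ⟨i, rfl⟩ := hyx
      exact (h0 i).ge
  have hcl : closure (Ioo (-1 : ℝ) 1) = Icc (-1) 1 := closure_Ioo (by norm_num)
  refine intervalIntegral.integral_pos (by norm_num) hFc (fun y hyI => ?_) ?_
  · exact le_on_closure (f := fun _ => (0 : ℝ)) hnonneg continuousOn_const (hcl ▸ hFc)
      (hcl ▸ Ioc_subset_Icc_self hyI)
  · obtain ⟨y, hyI, hyx⟩ := (Ioo_infinite (show (-1 : ℝ) < 1 by norm_num)).exists_notMem_finset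
      (Finset.univ.image x)
    exact ⟨y, Ioo_subset_Icc_self hyI, hy y hyI (by simpa using hyx)⟩

lemma exists_iteratedDeriv_eq_zero_of_integral_eq_zero (hn : 1 ≤ n)
    (hmem : ∀ i, x i ∈ Ioo (-1 : ℝ) 1)
    (hroot : ∀ i, (legendrePoly n).eval (x i) = 0) (hinj : Function.Injective x)
    (hFc : ContinuousOn F (Icc (-1 : ℝ) 1))
    (hF : ContDiffOn ℝ (2 * n : ℕ) F (Ioo (-1 : ℝ) 1))
    (h0 : ∀ i, F (x i) = 0) (h1 : ∀ i, deriv F (x i) = 0)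
    (hint : ∫ t in (-1 : ℝ)..1, F t = 0) :
    ∃ η ∈ Ioo (-1 : ℝ) 1, iteratedDeriv (2 * n) F η = 0 := by
  by_contra! hne
  have hcont : ContinuousOn (iteratedDeriv (2 * n) F) (Ioo (-1 : ℝ) 1) :=
    (hF.continuousOn_iteratedDerivWithin le_rfl isOpen_Ioo.uniqueDiffOn).congr
      (iteratedDerivWithin_of_isOpen isOpen_Ioo).symm
  by_cases hpos : ∀ y ∈ Ioo (-1 : ℝ) 1, 0 < iteratedDeriv (2 * n) F y
  · exact (integral_pos_of_iteratedDeriv_pos hn hmem hroot hinj hFc hF h0 h1 hpos).ne' hint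
  · push Not at hpos
    obtain ⟨y, hy, hy0⟩ := hpos
    have hneg : ∀ z ∈ Ioo (-1 : ℝ) 1, iteratedDeriv (2 * n) F z < 0 := by
      intro z hz
      by_contra! hz0
      obtain ⟨u, hu, hu0⟩ := isPreconnected_Ioo.intermediate_value hy hz hcont ⟨hy0, hz0⟩
      exact hne u hu hu0
    have h := integral_pos_of_iteratedDeriv_pos (F := fun t => - F t) hn hmem hroot hinj hFc.neg
      hF.neg (fun i => by simp [h0]) (fun i => by simp [h1]) (fun z hz => by
        rw [iteratedDeriv_fun_neg]
        exact neg_pos.mpr (hneg z hz))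
    rw [intervalIntegral.integral_neg, hint] at h
    simp at h

/-- Hermite interpolation of values and first derivatives at the roots. -/
lemma exists_hermite (hinj : Function.Injective x)
    (hroot : ∀ i, (legendrePoly n).eval (x i) = 0)
    (hderiv : ∀ i, (derivative (legendrePoly n)).eval (x i) ≠ 0) (u v : Fin n → ℝ) :
    ∃ H : ℝ[X], H.degree < (2 * n : ℕ) ∧ (∀ i, H.eval (x i) = u i) ∧
      ∀ i, (derivative H).eval (x i) = v i := by
  set A := Lagrange.interpolate Finset.univ x u with hA
  set B := Lagrange.interpolate Finset.univ x fun i =>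
    (v i - (derivative A).eval (x i)) / (derivative (legendrePoly n)).eval (x i) with hB
  have hAdeg : A.degree < n := by
    simpa only [Finset.card_univ, Fintype.card_fin] using
      Lagrange.degree_interpolate_lt (s := Finset.univ) u hinj.injOn
  have hBdeg : B.degree < n := by
    simpa only [Finset.card_univ, Fintype.card_fin] using
      Lagrange.degree_interpolate_lt (s := Finset.univ) (fun i =>
      (v i - (derivative A).eval (x i)) / (derivative (legendrePoly n)).eval (x i)) hinj.injOn
  have hAe : ∀ i, A.eval (x i) = u i := fun i =>
    Lagrange.eval_interpolate_at_node u hinj.injOn (Finset.mem_univ i)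
  have hBe : ∀ i, B.eval (x i)
      = (v i - (derivative A).eval (x i)) / (derivative (legendrePoly n)).eval (x i) := fun i =>
    Lagrange.eval_interpolate_at_node _ hinj.injOn (Finset.mem_univ i)
  refine ⟨A + legendrePoly n * B, ?_, ?_, ?_⟩
  · refine (degree_add_le _ _).trans_lt (max_lt ?_ ?_)
    · exact hAdeg.trans_le (by norm_cast; omega)
    · by_cases hB0 : B = 0
      · rw [hB0, mul_zero, degree_zero]
        exact WithBot.bot_lt_coe _
      · rw [degree_mul, degree_eq]
        rw [degree_eq_natDegree hB0] at hBdeg ⊢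
        norm_cast at hBdeg ⊢
        omega
  · intro i
    simp [hAe, hroot]
  · intro i
    have := hderiv i
    rw [derivative_add, derivative_mul, eval_add, eval_add, eval_mul, eval_mul, hroot, hBe]
    field_simp
    ring

end LegendrePoly

theorem gauss_legendre_formula (n : ℕ) (hn : 1 ≤ n) (x : Fin n → ℝ)
    (hmem : ∀ i, x i ∈ Set.Ioo (-1:ℝ) 1)
    (hroot : ∀ i, legendre n (x i) = 0)
    (hinj : Function.Injective x)
    (w : Fin n → ℝ)
    (hw : ∀ i, w i = 2 / ((1 - (x i)^2) * (deriv (legendre n) (x i))^2))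
    (f : ℝ → ℝ) (hf : ContDiffOn ℝ (2*n) f (Set.Icc (-1:ℝ) 1)) :
    ∃ η ∈ Set.Ioo (-1:ℝ) 1,
      ∫ t in (-1:ℝ)..1, f t
        = ∑ i, w i * f (x i)
          + ((Nat.factorial n : ℝ)^4 / (Nat.factorial (2*n) : ℝ)^3)
            * (2^(2*n+1) / (2*(n:ℝ)+1)) * iteratedDeriv (2*n) f η := by
  have hroot' : ∀ i, (legendrePoly n).eval (x i) = 0 := by
    simpa only [LegendrePoly.legendre_eq_eval] using hroot
  have hderiv : ∀ i, deriv (legendre n) (x i)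
      = (Polynomial.derivative (legendrePoly n)).eval (x i) := fun i => by
    rw [LegendrePoly.legendre_eq_eval, Polynomial.deriv]
  have hbasis := LegendrePoly.integral_basis_mul_sq hmem hroot' hinj
  have hsq : ∀ i, 0 < 1 - x i ^ 2 := fun i => by nlinarith [(hmem i).1, (hmem i).2]
  have hd0 : ∀ i, (Polynomial.derivative (legendrePoly n)).eval (x i) ≠ 0 := by
    intro i h
    have h2 := hbasis i
    rw [h] at h2
    have := div_pos two_pos (hsq i)
    simp at h2
    linarith
  have hwb : ∀ i, ∫ t in (-1 : ℝ)..1, (Lagrange.basis Finset.univ x i).eval t = w i := by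
    intro i
    rw [hw, hderiv, ← div_div, ← hbasis i]
    have := hd0 i
    field_simp
  obtain ⟨H, hHdeg, hH, hH'⟩ := LegendrePoly.exists_hermite hinj hroot' hd0 (fun i => f (x i))
    (fun i => deriv f (x i))
  have hHint : ∫ t in (-1 : ℝ)..1, H.eval t = ∑ i, w i * f (x i) := by
    rw [LegendrePoly.integral_eq_sum_basis hroot' hinj H hHdeg]
    simp only [hwb, hH]
  set E := (∫ t in (-1 : ℝ)..1, f t) - ∑ i, w i * f (x i) with hE
  set Q := H + Polynomial.C (E * (2 * n + 1) / 2) * legendrePoly n ^ 2 with hQ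
  have hN : (2 * (n : ℝ) + 1) ≠ 0 := by positivity
  have hfc : ContinuousOn f (Set.Icc (-1 : ℝ) 1) := hf.continuousOn
  have hfo : ContDiffOn ℝ (2 * n : ℕ) f (Set.Ioo (-1 : ℝ) 1) := by
    push_cast
    exact hf.mono Set.Ioo_subset_Icc_self
  have hFint : ∫ t in (-1 : ℝ)..1, (f t - Q.eval t) = 0 := by
    rw [intervalIntegral.integral_sub (hfc.intervalIntegrable_of_Icc (by norm_num))
      (LegendrePoly.intervalIntegrable Q _ _), hQ, LegendrePoly.integral_add,
      LegendrePoly.integral_C_mul, LegendrePoly.integral_sq, hHint]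
    field_simp
    rw [hE]
    ring
  have hfd : ∀ i, DifferentiableAt ℝ f (x i) := fun i =>
    (hfo.contDiffAt (isOpen_Ioo.mem_nhds (hmem i))).differentiableAt (by norm_cast; omega)
  obtain ⟨η, hη, hη0⟩ := LegendrePoly.exists_iteratedDeriv_eq_zero_of_integral_eq_zero
    (F := fun t => f t - Q.eval t) hn hmem hroot' hinj (hfc.sub Q.continuousOn)
    (hfo.sub (LegendrePoly.contDiff_eval Q _).contDiffOn) (fun i => by simp [hQ, hH, hroot'])
    (fun i => by
      rw [deriv_fun_sub (hfd i) Q.differentiableAt, Polynomial.deriv, hQ]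
      simp [hH', hroot', Polynomial.derivative_sq]) hFint
  refine ⟨η, hη, ?_⟩
  rw [LegendrePoly.iteratedDeriv_sub_eval isOpen_Ioo hfo Q hη, hQ, iterate_map_add,
    Polynomial.iterate_derivative_eq_zero_of_degree_lt hHdeg, zero_add,
    Polynomial.iterate_derivative_C_mul, LegendrePoly.iterate_derivative_sq, Polynomial.eval_mul,
    Polynomial.eval_C, Polynomial.eval_C, LegendrePoly.coeff_self, sub_eq_zero] at hη0
  rw [hη0, ← sub_eq_iff_eq_add', ← hE]
  have h1 : (n.factorial : ℝ) ≠ 0 := by positivity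
  have h2 : ((2 * n).factorial : ℝ) ≠ 0 := by positivity
  have h3 : (2 : ℝ) ^ (2 * n + 1) = 2 * (2 ^ n) ^ 2 := by rw [pow_succ, mul_comm 2 n, pow_mul]; ring
  rw [h3]
  field_simp
end
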